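/- There exists a constant K₃ > 1 such that for every word 𝐚 ∈ 𝒲, one has K₃⁻¹·Υ_{𝐚̄} ≤ Υ_𝐚 ≤ K₃·Υ_{𝐚̄}, where 𝐚̄ is the mirror of 𝐚. -/

import Mathlib

open MeasureTheory

/-- `SL(2,ℝ)`. -/
abbrev SL2 : Type := Matrix.SpecialLinearGroup (Fin 2) ℝ

/-- The Möbius transformation of `g ∈ SL(2,ℝ)` acting on `ℂ` (junk at the pole). -/
noncomputable def mobiusC (g : SL2) (z : ℂ) : ℂ :=
  ((g.1 0 0 : ℂ) * z + (g.1 0 1 : ℂ)) / ((g.1 1 0 : ℂ) * z + (g.1 1 1 : ℂ))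

/-- The Möbius transformation of `g ∈ SL(2,ℝ)` acting on `ℝ` (junk at the pole). -/
noncomputable def mobiusR (g : SL2) (x : ℝ) : ℝ :=
  (g.1 0 0 * x + g.1 0 1) / (g.1 1 0 * x + g.1 1 1)

/-- The derivative `γ'(z) = (uz+v)⁻²` of the Möbius transformation of `g`. -/
noncomputable def mobiusDerivC (g : SL2) (z : ℂ) : ℂ :=
  ((g.1 1 0 : ℂ) * z + (g.1 1 1 : ℂ))⁻¹ ^ 2

/-- The derivative `γ'(x) = (ux+v)⁻²` of the Möbius transformation of `g`, real version. -/
noncomputable def mobiusDerivR (g : SL2) (x : ℝ) : ℝ :=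
  (g.1 1 0 * x + g.1 1 1)⁻¹ ^ 2

/-- The Möbius transformation of `g ∈ SL(2,ℝ)` acting on the Riemann sphere `ℂ ∪ {∞}`. -/
noncomputable def mobiusS (g : SL2) (z : OnePoint ℂ) : OnePoint ℂ :=
  Option.elim z
    (if (g.1 1 0 : ℝ) = 0 then OnePoint.infty else (((g.1 0 0 / g.1 1 0 : ℝ) : ℂ) : OnePoint ℂ))
    (fun w => if ((g.1 1 0 : ℂ) * w + (g.1 1 1 : ℂ)) = 0 then OnePoint.infty
      else ((mobiusC g w : ℂ) : OnePoint ℂ))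

/-- The involution `a ↦ ā = a + r mod 2r` on the alphabet `𝒜 = Fin (2r)`. -/
def wordBar {r : ℕ} (a : Fin (2 * r)) : Fin (2 * r) :=
  ⟨(a.1 + r) % (2 * r), Nat.mod_lt _ (Nat.lt_of_le_of_lt (Nat.zero_le _) a.isLt)⟩

/-- A word: a finite sequence of letters with no adjacent letter equal to the bar of the
previous one. -/
def IsWord {r : ℕ} (w : List (Fin (2 * r))) : Prop :=
  w.Chain' (fun x y => x ≠ wordBar y)

/-- The mirror word `𝐚̄ = (ā_n, …, ā_1)`. -/
def mirror {r : ℕ} (w : List (Fin (2 * r))) : List (Fin (2 * r)) :=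
  (w.map wordBar).reverse

/-- `𝐚 → 𝐛` : either word is empty, or the last letter of `𝐚` is not the bar of the first
letter of `𝐛`. -/
def arrow {r : ℕ} (w v : List (Fin (2 * r))) : Prop :=
  ∀ x ∈ w.getLast?, ∀ y ∈ v.head?, x ≠ wordBar y

/-- `𝐚 ⇝ 𝐛` : both words are nonempty and the last letter of `𝐚` equals the first letter
of `𝐛`. -/
def wiggly {r : ℕ} (w v : List (Fin (2 * r))) : Prop :=
  w ≠ [] ∧ v ≠ [] ∧ w.getLast? = v.head?

/-- Schottky data: pairwise disjoint closed discs centered on the real line, paired by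
elements of `SL(2,ℝ)`. -/
structure Schottky where
  r : ℕ
  two_le_r : 2 ≤ r
  center : Fin (2 * r) → ℝ
  radius : Fin (2 * r) → ℝ
  radius_pos : ∀ a, 0 < radius a
  g : Fin (2 * r) → SL2
  disjoint : ∀ a b : Fin (2 * r), a ≠ b →
    Disjoint (closure (Metric.ball ((center a : ℂ)) (radius a)))
             (closure (Metric.ball ((center b : ℂ)) (radius b)))
  g_bar : ∀ a : Fin (2 * r), g (wordBar a) = (g a)⁻¹
  maps : ∀ a : Fin (2 * r),
    mobiusS (g a) '' (((fun w : ℂ => (w : OnePoint ℂ)) ''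
        Metric.ball ((center (wordBar a) : ℂ)) (radius (wordBar a)))ᶜ)
      = (fun w : ℂ => (w : OnePoint ℂ)) '' closure (Metric.ball ((center a : ℂ)) (radius a))

namespace Schottky

variable (S : Schottky)

/-- The open disc `D_a`. -/
def D (a : Fin (2 * S.r)) : Set ℂ := Metric.ball ((S.center a : ℂ)) (S.radius a)

/-- The union `𝐃` of the open discs. -/
def Dall : Set ℂ := ⋃ a, S.D a

/-- The open interval `I_a = D_a ∩ ℝ`. -/
def Ireal (a : Fin (2 * S.r)) : Set ℝ := {x : ℝ | (x : ℂ) ∈ S.D a}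

/-- The union `I` of the intervals `I_a`. -/
def Iall : Set ℝ := ⋃ a, S.Ireal a

/-- The group element `γ_𝐚 = γ_{a₁} ⋯ γ_{a_n}` associated to a word. -/
noncomputable def wprod (w : List (Fin (2 * S.r))) : SL2 := (w.map S.g).prod

/-- The Schottky group `Γ`, generated by the `γ_a`. -/
def SGroup : Subgroup SL2 := Subgroup.closure (Set.range S.g)

theorem wprod_mem (w : List (Fin (2 * S.r))) : S.wprod w ∈ S.SGroup := by
  apply Subgroup.list_prod_mem
  intro x hx
  obtain ⟨a, -, rfl⟩ := List.mem_map.mp hx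
  exact Subgroup.subset_closure ⟨a, rfl⟩

/-- `γ_𝐚` as an element of the Schottky group `Γ`. -/
noncomputable def wprodG (w : List (Fin (2 * S.r))) : S.SGroup := ⟨S.wprod w, S.wprod_mem w⟩

/-- The generator `γ_a` as an element of `Γ`. -/
noncomputable def genG (a : Fin (2 * S.r)) : S.SGroup :=
  ⟨S.g a, Subgroup.subset_closure ⟨a, rfl⟩⟩

/-- The interval `I_𝐚 = γ_{𝐚'}(I_{a_n})` of a nonempty word. -/
noncomputable def Iset (w : List (Fin (2 * S.r))) : Set ℝ :=
  if h : w = [] then ∅ else mobiusR (S.wprod w.dropLast) '' S.Ireal (w.getLast h)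

/-- `Υ_𝐚 = |I_𝐚|`, the length of the interval `I_𝐚`; `Υ_∅ = 1`. -/
noncomputable def ups (w : List (Fin (2 * S.r))) : ℝ :=
  if w = [] then 1 else (volume (S.Iset w)).toReal

/-- The Bourgain–Dyatlov partition `Z(τ)`. -/
def Zset (τ : ℝ) : Set (List (Fin (2 * S.r))) :=
  {w | IsWord w ∧ w ≠ [] ∧ S.ups w ≤ τ ∧ τ < S.ups w.dropLast}

/-- The mirror set `Z̄(τ) = {𝐚 ∈ 𝒲 : 𝐚̄ ∈ Z(τ)}`. -/
def Zbar (τ : ℝ) : Set (List (Fin (2 * S.r))) :=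
  {w | IsWord w ∧ mirror w ∈ S.Zset τ}

open Classical in
/-- The Bowen–Series map on the Riemann sphere (junk value `∞` off `𝐃`). -/
noncomputable def TS (z : OnePoint ℂ) : OnePoint ℂ :=
  if h : ∃ a : Fin (2 * S.r), ∃ w : ℂ, z = (w : OnePoint ℂ) ∧ w ∈ S.D a
  then mobiusS (S.g h.choose)⁻¹ z
  else OnePoint.infty

/-- The limit set `Λ`: points of `𝐃` all of whose forward iterates under the Bowen–Series
map are defined (finite) and remain in `𝐃`. -/
def limitSet : Set ℂ :=
  {z : ℂ | ∀ n : ℕ, ∃ w : ℂ, (S.TS)^[n] (z : OnePoint ℂ) = (w : OnePoint ℂ) ∧ w ∈ S.Dall}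

/-- The limit set, viewed inside `ℝ`. -/
def limitSetR : Set ℝ := {x : ℝ | (x : ℂ) ∈ S.limitSet}

/-- `δ`, the Hausdorff dimension of the limit set. -/
noncomputable def delta : ℝ := (dimH S.limitSet).toReal

/-- `PowerPairs(τ)`: pairs `(𝐚,𝐛) ∈ Z̄(τ)²` such that `γ_{𝐚'}γ_{𝐛'}⁻¹` is a nontrivial
proper power in `Γ`. -/
def PowerPairs (τ : ℝ) : Set (List (Fin (2 * S.r)) × List (Fin (2 * S.r))) :=
  {p | p.1 ∈ S.Zbar τ ∧ p.2 ∈ S.Zbar τ ∧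
    S.wprod p.1.dropLast * (S.wprod p.2.dropLast)⁻¹ ≠ 1 ∧
    ∃ γ₀ ∈ S.SGroup, ∃ q : ℕ, 2 ≤ q ∧
      S.wprod p.1.dropLast * (S.wprod p.2.dropLast)⁻¹ = (γ₀ : SL2) ^ q}

end Schottky

lemma wordBar_wordBar {r : ℕ} (a : Fin (2 * r)) : wordBar (wordBar a) = a := by
  apply Fin.ext
  have ha := a.isLt
  simp only [wordBar]
  rw [Nat.mod_add_mod, show a.1 + r + r = a.1 + 2 * r by ring, Nat.add_mod_right,
    Nat.mod_eq_of_lt ha]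

lemma mirror_eq_nil_iff {r : ℕ} {w : List (Fin (2 * r))} : mirror w = [] ↔ w = [] := by
  simp [mirror]

lemma IsWord.mirror {r : ℕ} {w : List (Fin (2 * r))} (hw : IsWord w) : IsWord (mirror w) := by
  change List.IsChain _ (w.map wordBar).reverse
  rw [List.isChain_reverse, List.isChain_map]
  refine List.IsChain.imp (fun x y hxy h => hxy ?_) hw
  rw [h, wordBar_wordBar]

lemma SL2_inv_apply_one_zero (g : SL2) : (g⁻¹).1 1 0 = -g.1 1 0 := by
  rw [Matrix.SpecialLinearGroup.coe_inv, Matrix.adjugate_fin_two]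
  simp

lemma SL2_inv_apply_zero_zero (g : SL2) : (g⁻¹).1 0 0 = g.1 1 1 := by
  rw [Matrix.SpecialLinearGroup.coe_inv, Matrix.adjugate_fin_two]
  simp

/-- The Möbius transformation of `g` maps an interval that avoids its pole onto the interval
between the images of the endpoints. -/
lemma volume_mobiusR_image_Ioo (g : SL2) {x y : ℝ} (hxy : x < y)
    (hpole : ∀ z ∈ Set.Icc x y, g.1 1 0 * z + g.1 1 1 ≠ 0) :
    (volume (mobiusR g '' Set.Ioo x y)).toReal =
      (y - x) / ((g.1 1 0 * x + g.1 1 1) * (g.1 1 0 * y + g.1 1 1)) := by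
  have hdet := Matrix.det_fin_two g.1
  rw [g.2] at hdet
  have hpos : ∀ u ∈ Set.Icc x y, ∀ v ∈ Set.Icc x y,
      0 < (g.1 1 0 * u + g.1 1 1) * (g.1 1 0 * v + g.1 1 1) := by
    intro u hu v hv
    by_contra! h
    have hc : ContinuousOn (fun z => g.1 1 0 * z + g.1 1 1) (Set.Icc x y) := by fun_prop
    have hconn := (isPreconnected_Icc.image _ hc).ordConnected
    have h0 : (0 : ℝ) ∈ (fun z => g.1 1 0 * z + g.1 1 1) '' Set.Icc x y := by
      rcases mul_nonpos_iff.1 h with ⟨h1, h2⟩ | ⟨h1, h2⟩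
      · exact hconn.out ⟨v, hv, rfl⟩ ⟨u, hu, rfl⟩ ⟨h2, h1⟩
      · exact hconn.out ⟨u, hu, rfl⟩ ⟨v, hv, rfl⟩ ⟨h1, h2⟩
    obtain ⟨z, hz, hz0⟩ := h0
    exact hpole z hz hz0
  have hsub : ∀ u ∈ Set.Icc x y, ∀ v ∈ Set.Icc x y, mobiusR g v - mobiusR g u =
      (v - u) / ((g.1 1 0 * u + g.1 1 1) * (g.1 1 0 * v + g.1 1 1)) := by
    intro u hu v hv
    have h1 := hpole u hu
    have h2 := hpole v hv
    unfold mobiusR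
    rw [div_sub_div _ _ h2 h1, mul_comm (g.1 1 0 * u + g.1 1 1)]
    congr 1
    linear_combination (u - v) * hdet
  have hmono : StrictMonoOn (mobiusR g) (Set.Icc x y) := by
    intro u hu v hv huv
    rw [← sub_pos, hsub u hu v hv]
    exact div_pos (sub_pos.2 huv) (hpos u hu v hv)
  have hcont : ContinuousOn (mobiusR g) (Set.Icc x y) :=
    ContinuousOn.div (by fun_prop) (by fun_prop) hpole
  have hx : x ∈ Set.Icc x y := Set.left_mem_Icc.2 hxy.le
  have hy : y ∈ Set.Icc x y := Set.right_mem_Icc.2 hxy.le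
  have himage : mobiusR g '' Set.Ioo x y = Set.Ioo (mobiusR g x) (mobiusR g y) := by
    refine Set.Subset.antisymm ?_ (intermediate_value_Ioo hxy.le hcont)
    rintro _ ⟨z, hz, rfl⟩
    have hz' := Set.Ioo_subset_Icc_self hz
    exact ⟨hmono hx hz' hz.1, hmono hz' hy hz.2⟩
  rw [himage, Real.volume_Ioo, hsub x hx y hy, ENNReal.toReal_ofReal]
  exact div_nonneg (sub_pos.2 hxy).le (hpos x hx y hy).le

namespace Schottky

variable (S : Schottky)

lemma Ireal_eq_Ioo (a : Fin (2 * S.r)) :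
    S.Ireal a = Set.Ioo (S.center a - S.radius a) (S.center a + S.radius a) := by
  rw [← Real.ball_eq_Ioo]
  ext x
  simp only [Ireal, D, Set.mem_ofPred_eq, Metric.mem_ball, Complex.dist_eq, Real.dist_eq,
    ← Complex.ofReal_sub, Complex.norm_real, Real.norm_eq_abs]

lemma radius_add_radius_lt {a b : Fin (2 * S.r)} (hab : a ≠ b) :
    S.radius a + S.radius b < |S.center a - S.center b| := by
  have h := S.disjoint a b hab
  rw [closure_ball _ (S.radius_pos a).ne', closure_ball _ (S.radius_pos b).ne',
    disjoint_closedBall_closedBall_iff (S.radius_pos a).le (S.radius_pos b).le] at h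
  rwa [Complex.dist_eq, ← Complex.ofReal_sub, Complex.norm_real] at h

/-- Points of closed intervals attached to distinct letters are uniformly separated. -/
lemma exists_separation : ∃ δ Δ : ℝ, 0 < δ ∧ δ ≤ Δ ∧ ∀ a b : Fin (2 * S.r), a ≠ b →
    ∀ x y : ℝ, |x - S.center a| ≤ S.radius a → |y - S.center b| ≤ S.radius b →
      δ ≤ |x - y| ∧ |x - y| ≤ Δ := by
  classical
  have hr := S.two_le_r
  have : Nonempty (Fin (2 * S.r)) := ⟨⟨0, by omega⟩⟩
  let f : Fin (2 * S.r) × Fin (2 * S.r) → ℝ := fun p =>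
    if p.1 = p.2 then 1 else |S.center p.1 - S.center p.2| - S.radius p.1 - S.radius p.2
  have hf : ∀ p, 0 < f p := by
    intro p
    by_cases h : p.1 = p.2
    · simp [f, h]
    · have := S.radius_add_radius_lt h
      simp only [f, h, if_false]
      linarith
  obtain ⟨p₀, hp₀⟩ := Finite.exists_min f
  obtain ⟨p₁, hp₁⟩ := Finite.exists_max fun p : Fin (2 * S.r) × Fin (2 * S.r) =>
    |S.center p.1 - S.center p.2| + S.radius p.1 + S.radius p.2
  refine ⟨f p₀, max (f p₀) (|S.center p₁.1 - S.center p₁.2| + S.radius p₁.1 + S.radius p₁.2),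
    hf p₀, le_max_left _ _, fun a b hab x y hx hy => ⟨(hp₀ (a, b)).trans ?_,
      le_trans ?_ ((hp₁ (a, b)).trans (le_max_right _ _))⟩⟩
  · simp only [f, hab, if_false]
    have h1 := abs_sub_le (S.center a) x (S.center b)
    have h2 := abs_sub_le x y (S.center b)
    rw [abs_sub_comm (S.center a) x] at h1
    linarith
  · dsimp only
    have h1 := abs_sub_le x (S.center a) y
    have h2 := abs_sub_le (S.center a) (S.center b) y
    rw [abs_sub_comm (S.center b) y] at h2
    linarith

lemma mobiusS_mem (a : Fin (2 * S.r)) {z : OnePoint ℂ}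
    (hz : z ∉ (fun w : ℂ => (w : OnePoint ℂ)) ''
      Metric.ball ((S.center (wordBar a) : ℂ)) (S.radius (wordBar a))) :
    ∃ w : ℂ, ‖w - S.center a‖ ≤ S.radius a ∧ (w : OnePoint ℂ) = mobiusS (S.g a) z := by
  have h : mobiusS (S.g a) z ∈ (fun w : ℂ => (w : OnePoint ℂ)) ''
      closure (Metric.ball ((S.center a : ℂ)) (S.radius a)) := by
    rw [← S.maps a]
    exact ⟨z, hz, rfl⟩
  obtain ⟨w, hw, hwz⟩ := h
  rw [closure_ball _ (S.radius_pos a).ne', mem_closedBall_iff_norm] at hw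
  exact ⟨w, hw, hwz⟩

lemma gen_infty (a : Fin (2 * S.r)) : (S.g a).1 1 0 ≠ 0 ∧
    |(S.g a).1 0 0 / (S.g a).1 1 0 - S.center a| ≤ S.radius a := by
  obtain ⟨w, hw, h⟩ := S.mobiusS_mem a (z := OnePoint.infty) (by simp)
  by_cases hc : (S.g a).1 1 0 = 0
  · have : mobiusS (S.g a) OnePoint.infty = OnePoint.infty := if_pos hc
    rw [this] at h
    exact absurd h (OnePoint.coe_ne_infty w)
  · have : mobiusS (S.g a) OnePoint.infty =
        (((S.g a).1 0 0 / (S.g a).1 1 0 : ℝ) : ℂ) := if_neg hc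
    rw [this, OnePoint.coe_eq_coe] at h
    rw [h, ← Complex.ofReal_sub, Complex.norm_real] at hw
    exact ⟨hc, hw⟩

lemma gen_apply (a : Fin (2 * S.r)) {x : ℝ}
    (hx : S.radius (wordBar a) ≤ |x - S.center (wordBar a)|) :
    (S.g a).1 1 0 * x + (S.g a).1 1 1 ≠ 0 ∧
      |mobiusR (S.g a) x - S.center a| ≤ S.radius a := by
  obtain ⟨w, hw, h⟩ := S.mobiusS_mem a (z := ((x : ℂ) : OnePoint ℂ)) (by
    rintro ⟨y, hy, hyx⟩
    rw [OnePoint.coe_eq_coe] at hyx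
    rw [hyx, mem_ball_iff_norm, ← Complex.ofReal_sub, Complex.norm_real] at hy
    exact absurd hy (not_lt.2 hx))
  by_cases hc : (S.g a).1 1 0 * x + (S.g a).1 1 1 = 0
  · have : mobiusS (S.g a) ((x : ℂ) : OnePoint ℂ) = OnePoint.infty :=
      if_pos (by exact_mod_cast congrArg Complex.ofReal hc)
    rw [this] at h
    exact absurd h (OnePoint.coe_ne_infty w)
  · have : mobiusS (S.g a) ((x : ℂ) : OnePoint ℂ) = (mobiusC (S.g a) x : ℂ) :=
      if_neg (by exact_mod_cast hc)
    rw [this, OnePoint.coe_eq_coe] at h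
    have hR : mobiusC (S.g a) x = ((mobiusR (S.g a) x : ℝ) : ℂ) := by
      simp [mobiusC, mobiusR]
    rw [h, hR, ← Complex.ofReal_sub, Complex.norm_real] at hw
    exact ⟨hc, hw⟩

/-- The image of `∞` under `γ_𝐚` is finite and lies in the closed disc of the first letter. -/
lemma wprod_infty (b : Fin (2 * S.r)) (v : List (Fin (2 * S.r))) (hv : IsWord (b :: v)) :
    (S.wprod (b :: v)).1 1 0 ≠ 0 ∧
      |(S.wprod (b :: v)).1 0 0 / (S.wprod (b :: v)).1 1 0 - S.center b| ≤ S.radius b := by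
  induction v generalizing b with
  | nil => simpa [wprod] using S.gen_infty b
  | cons d v ih =>
    obtain ⟨hbd, hdv⟩ := List.isChain_cons_cons.1 hv
    obtain ⟨hc, hy⟩ := ih d hdv
    set h := S.wprod (d :: v) with hh
    have hprod : S.wprod (b :: d :: v) = S.g b * h := by simp [wprod, hh]
    have hne : d ≠ wordBar b := fun e => hbd (by rw [e, wordBar_wordBar])
    have hfar : S.radius (wordBar b) ≤ |h.1 0 0 / h.1 1 0 - S.center (wordBar b)| := by
      have h1 := S.radius_add_radius_lt hne
      have h2 := abs_sub_le (S.center d) (h.1 0 0 / h.1 1 0) (S.center (wordBar b))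
      rw [abs_sub_comm (S.center d) (h.1 0 0 / h.1 1 0)] at h2
      linarith
    obtain ⟨hp, hq⟩ := S.gen_apply b hfar
    have e0 : (S.wprod (b :: d :: v)).1 0 0 =
        h.1 1 0 * ((S.g b).1 0 0 * (h.1 0 0 / h.1 1 0) + (S.g b).1 0 1) := by
      rw [hprod, Matrix.SpecialLinearGroup.coe_mul, Matrix.mul_apply, Fin.sum_univ_two]
      field_simp
    have e1 : (S.wprod (b :: d :: v)).1 1 0 =
        h.1 1 0 * ((S.g b).1 1 0 * (h.1 0 0 / h.1 1 0) + (S.g b).1 1 1) := by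
      rw [hprod, Matrix.SpecialLinearGroup.coe_mul, Matrix.mul_apply, Fin.sum_univ_two]
      field_simp
    rw [e0, e1, mul_div_mul_left _ _ hc]
    exact ⟨mul_ne_zero hc hp, hq⟩

lemma wprod_mirror (w : List (Fin (2 * S.r))) : S.wprod (mirror w) = (S.wprod w)⁻¹ := by
  rw [wprod, wprod, List.prod_inv_reverse, mirror, List.map_reverse, List.map_map, List.map_map]
  congr 3
  funext a
  exact S.g_bar a

/-- The pole of `γ_𝐚` lies in the closed disc of the bar of the last letter. -/
lemma wprod_pole (v : List (Fin (2 * S.r))) (b : Fin (2 * S.r)) (hv : IsWord (v ++ [b])) :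
    ∃ p : ℝ, (S.wprod (v ++ [b])).1 1 0 ≠ 0 ∧ |p - S.center (wordBar b)| ≤ S.radius (wordBar b) ∧
      ∀ x, (S.wprod (v ++ [b])).1 1 0 * x + (S.wprod (v ++ [b])).1 1 1 =
        (S.wprod (v ++ [b])).1 1 0 * (x - p) := by
  have hm : mirror (v ++ [b]) = wordBar b :: mirror v := by simp [mirror]
  have h := S.wprod_infty (wordBar b) (mirror v) (hm ▸ hv.mirror)
  rw [← hm, wprod_mirror, SL2_inv_apply_one_zero, SL2_inv_apply_zero_zero] at h
  have hc : (S.wprod (v ++ [b])).1 1 0 ≠ 0 := neg_ne_zero.1 h.1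
  refine ⟨_, hc, h.2, fun x => ?_⟩
  field_simp
  ring

lemma ups_concat (v : List (Fin (2 * S.r))) (a : Fin (2 * S.r)) :
    S.ups (v ++ [a]) = (volume (mobiusR (S.wprod v) ''
      Set.Ioo (S.center a - S.radius a) (S.center a + S.radius a))).toReal := by
  simp [ups, Iset, Ireal_eq_Ioo]

lemma ups_singleton (a : Fin (2 * S.r)) : S.ups [a] = 2 * S.radius a := by
  have h := S.ups_concat [] a
  have hr := S.radius_pos a
  rw [volume_mobiusR_image_Ioo _ (by linarith) (by simp [wprod])] at h
  simp only [List.nil_append] at h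
  rw [h]
  simp [wprod]
  ring

lemma ups_mul_sq_concat_concat {δ Δ : ℝ} (hδ : 0 < δ)
    (hsep : ∀ a b : Fin (2 * S.r), a ≠ b →
      ∀ x y : ℝ, |x - S.center a| ≤ S.radius a → |y - S.center b| ≤ S.radius b →
        δ ≤ |x - y| ∧ |x - y| ≤ Δ)
    (v : List (Fin (2 * S.r))) (b a : Fin (2 * S.r)) (hw : IsWord (v ++ [b] ++ [a])) :
    ∃ t : ℝ, δ ^ 2 / Δ ^ 2 ≤ t ∧ t ≤ Δ ^ 2 / δ ^ 2 ∧
      S.ups (v ++ [b] ++ [a]) * (S.wprod (v ++ [b] ++ [a])).1 1 0 ^ 2 =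
        2 * S.radius a * (S.g a).1 1 0 ^ 2 * t := by
  have hchain := List.isChain_append.1 hw
  have hba : b ≠ wordBar a := hchain.2.2 b (by simp) a (by simp)
  have hne : a ≠ wordBar b := fun e => hba (by rw [e, wordBar_wordBar])
  obtain ⟨p, hc, hp, hpole⟩ := S.wprod_pole v b hchain.1
  obtain ⟨hca, hq⟩ := S.gen_infty a
  have hr := S.radius_pos a
  set x := S.center a - S.radius a with hx
  set y := S.center a + S.radius a with hy
  set q := (S.g a).1 0 0 / (S.g a).1 1 0 with hqdef
  have hdist : ∀ z, |z - S.center a| ≤ S.radius a → δ ≤ |z - p| ∧ |z - p| ≤ Δ :=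
    fun z hz => hsep a (wordBar b) hne z p hz hp
  obtain ⟨hq1, hq2⟩ := hdist q hq
  obtain ⟨hx1, hx2⟩ := hdist x (by rw [hx, sub_sub_cancel_left, abs_neg, abs_of_pos hr])
  obtain ⟨hy1, hy2⟩ := hdist y (by rw [hy, add_sub_cancel_left, abs_of_pos hr])
  have hΔ : 0 < Δ := hδ.trans_le (hx1.trans hx2)
  have hIcc : ∀ z ∈ Set.Icc x y, z - p ≠ 0 := by
    intro z hz
    rw [← abs_pos]
    refine hδ.trans_le (hdist z (abs_le.2 ⟨?_, ?_⟩)).1 <;> linarith [hz.1, hz.2]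
  have hprod : 0 < (x - p) * (y - p) := by
    rcases lt_trichotomy p x with h | h | h
    · exact mul_pos (by linarith) (by linarith)
    · exact absurd (sub_eq_zero.2 h.symm) (hIcc x ⟨le_rfl, by linarith⟩)
    · rcases le_or_gt p y with h' | h'
      · exact absurd (sub_self p) (hIcc p ⟨h.le, h'⟩)
      · exact mul_pos_of_neg_of_neg (by linarith) (by linarith)
  have hxy : (x - p) * (y - p) = |x - p| * |y - p| := by rw [← abs_mul, abs_of_pos hprod]
  have hlow : δ ^ 2 ≤ (x - p) * (y - p) := by rw [hxy, sq]; gcongr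
  have hupp : (x - p) * (y - p) ≤ Δ ^ 2 := by rw [hxy, sq]; gcongr
  have hqlow : δ ^ 2 ≤ (q - p) ^ 2 := by rw [← sq_abs (q - p)]; gcongr
  have hqupp : (q - p) ^ 2 ≤ Δ ^ 2 := by rw [← sq_abs (q - p)]; gcongr
  refine ⟨(q - p) ^ 2 / ((x - p) * (y - p)), by gcongr, by gcongr, ?_⟩
  have hups : S.ups (v ++ [b] ++ [a]) = _ := S.ups_concat (v ++ [b]) a
  rw [volume_mobiusR_image_Ioo _ (by linarith)
    (fun z hz => by rw [hpole]; exact mul_ne_zero hc (hIcc z hz)), ← hx, ← hy, hpole, hpole] at hups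
  have hentry : (S.wprod (v ++ [b] ++ [a])).1 1 0 =
      (S.wprod (v ++ [b])).1 1 0 * (S.g a).1 1 0 * (q - p) := by
    have hmul : S.wprod (v ++ [b] ++ [a]) = S.wprod (v ++ [b]) * S.g a := by simp [wprod, mul_assoc]
    have h1 := hpole 0
    rw [hmul, Matrix.SpecialLinearGroup.coe_mul, Matrix.mul_apply, Fin.sum_univ_two]
    have h2 : (S.g a).1 0 0 = q * (S.g a).1 1 0 := by rw [hqdef, div_mul_cancel₀ _ hca]
    linear_combination (S.wprod (v ++ [b])).1 1 0 * h2 + (S.g a).1 1 0 * h1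
  have hxp := left_ne_zero_of_mul hprod.ne'
  have hyp := right_ne_zero_of_mul hprod.ne'
  rw [hups, hentry, show y - x = 2 * S.radius a by rw [hx, hy]; ring]
  field_simp

/-- The length `Υ_𝐚` is comparable to `u⁻²`, where `u` is the lower left entry of `γ_𝐚`. -/
lemma exists_ups_mul_sq_bounds : ∃ m M : ℝ, 0 < m ∧
    ∀ w : List (Fin (2 * S.r)), IsWord w → w ≠ [] →
      m ≤ S.ups w * (S.wprod w).1 1 0 ^ 2 ∧ S.ups w * (S.wprod w).1 1 0 ^ 2 ≤ M := by
  obtain ⟨δ, Δ, hδ, hδΔ, hsep⟩ := S.exists_separation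
  have hΔ : 0 < Δ := hδ.trans_le hδΔ
  have hr := S.two_le_r
  have : Nonempty (Fin (2 * S.r)) := ⟨⟨0, by omega⟩⟩
  let f : Fin (2 * S.r) → ℝ := fun a => 2 * S.radius a * (S.g a).1 1 0 ^ 2
  have hf : ∀ a, 0 < f a := fun a =>
    mul_pos (mul_pos two_pos (S.radius_pos a)) (sq_pos_of_ne_zero (S.gen_infty a).1)
  obtain ⟨a₀, ha₀⟩ := Finite.exists_min f
  obtain ⟨a₁, ha₁⟩ := Finite.exists_max f
  have key : ∀ w : List (Fin (2 * S.r)), IsWord w → w ≠ [] → ∃ (a : Fin (2 * S.r)) (t : ℝ),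
      δ ^ 2 / Δ ^ 2 ≤ t ∧ t ≤ Δ ^ 2 / δ ^ 2 ∧
        S.ups w * (S.wprod w).1 1 0 ^ 2 = f a * t := by
    intro w hw hne
    obtain rfl | ⟨v, a, rfl⟩ := w.eq_nil_or_concat'
    · exact absurd rfl hne
    obtain rfl | ⟨v, b, rfl⟩ := v.eq_nil_or_concat'
    · refine ⟨a, 1, ?_, ?_, ?_⟩
      · rw [div_le_one (by positivity)]; gcongr
      · rw [one_le_div (by positivity)]; gcongr
      · rw [List.nil_append, ups_singleton]; simp [f, wprod]
    · exact ⟨a, S.ups_mul_sq_concat_concat hδ hsep v b a hw⟩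
  have hm : 0 < δ ^ 2 / Δ ^ 2 := by positivity
  refine ⟨f a₀ * (δ ^ 2 / Δ ^ 2), f a₁ * (Δ ^ 2 / δ ^ 2), mul_pos (hf a₀) hm,
    fun w hw hne => ?_⟩
  obtain ⟨a, t, ht1, ht2, h⟩ := key w hw hne
  rw [h]
  exact ⟨mul_le_mul (ha₀ a) ht1 hm.le (hf a).le,
    mul_le_mul (ha₁ a) ht2 (hm.le.trans ht1) (hf a₁).le⟩

end Schottky

/-- mirror estimate: there is `K₃ > 1` such that
`K₃⁻¹ Υ_{𝐚̄} ≤ Υ_𝐚 ≤ K₃ Υ_{𝐚̄}` for every word `𝐚`. -/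
theorem stmt_4 (S : Schottky) :
    ∃ K₃ : ℝ, 1 < K₃ ∧
      ∀ w : List (Fin (2 * S.r)), IsWord w →
        K₃⁻¹ * S.ups (mirror w) ≤ S.ups w ∧ S.ups w ≤ K₃ * S.ups (mirror w) := by
  obtain ⟨m, M, hm, hbounds⟩ := S.exists_ups_mul_sq_bounds
  have hK : 1 < 2 + |M| / m := by
    have : 0 ≤ |M| / m := by positivity
    linarith
  have hMK : M ≤ (2 + |M| / m) * m := by
    rw [add_mul, div_mul_cancel₀ _ hm.ne']
    linarith [le_abs_self M]
  generalize 2 + |M| / m = K at hK hMK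
  have hK0 : 0 < K := one_pos.trans hK
  refine ⟨K, hK, fun w hw => ?_⟩
  rw [inv_mul_le_iff₀ hK0]
  by_cases hne : w = []
  · subst hne
    simp [mirror, Schottky.ups, hK.le]
  obtain ⟨h1, h2⟩ := hbounds w hw hne
  obtain ⟨h3, h4⟩ := hbounds (mirror w) hw.mirror (mt mirror_eq_nil_iff.1 hne)
  rw [S.wprod_mirror, SL2_inv_apply_one_zero, neg_sq] at h3 h4
  have hc : 0 < (S.wprod w).1 1 0 ^ 2 := by
    refine lt_of_le_of_ne (sq_nonneg _) fun h => ?_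
    rw [← h, mul_zero] at h1
    exact absurd h1 (not_le.2 hm)
  constructor <;> refine le_of_mul_le_mul_right ?_ hc <;> rw [mul_assoc]
  · exact h4.trans (hMK.trans (by gcongr))
  · exact h2.trans (hMK.trans (by gcongr))
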